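/- (Theorem 3.) Assume 0 ≤ p01 ≤ p11 ≤ 1 and β ∈ (0,1]. In the batteryless model with reward R(v) = p·Σ_{i=1}^K v_i, the myopic policy is optimal: for every scheduling policy π, every time 1 ≤ n ≤ T, and every belief vector s ∈ [0,1]^N, V^π_n(s) ≤ W_n(sort(s)), where sort(s) is s rearranged in decreasing order. -/

import Mathlib

/-- The set of scheduled indices `{1,…,K}` (the first `K` coordinates). -/
def sched (N K : ℕ) : Finset (Fin N) := Finset.univ.filter (fun i => i.val < K)

/-- Sort the entries of a vector in decreasing order. -/
noncomputable def sortVec (N : ℕ) (v : Fin N → ℝ) : Fin N → ℝ :=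
  fun i => ((List.ofFn v).mergeSort (fun a b => decide (b ≤ a))).getD i.val 0

/-- The next belief vector `[P11(Σl), τ(v_Ē), P01(|E|-Σl)]` of the batteryless model:
`|H|` entries `p11` (the active coordinates `H ⊆ E` found harvesting), then
`τ(x) = (p11 - p01)·x + p01` applied entrywise to the coordinates of `v` outside the active
set `E` (kept in their original order), then `|E| - |H|` entries `p01`. -/
noncomputable def nextVec2 (N : ℕ) (p01 p11 : ℝ) (E H : Finset (Fin N)) (v : Fin N → ℝ) :
    Fin N → ℝ :=
  fun i => (List.replicate H.card p11 ++
      ((Finset.univ \ E).sort (· ≤ ·)).map (fun j => (p11 - p01) * v j + p01) ++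
      List.replicate (E.card - H.card) p01).getD i.val 0

/-- The pseudo value function of the batteryless model, indexed by remaining time:
`W2 … m v` is the pseudo value function `W_n(v)` of the paper with `m = T - n` slots
remaining after the current one; `W2 … 0 v = p·Σ_{i=1}^K v_i` and
`W2 … (m+1) v = p·Σ_{i=1}^K v_i + β·Σ_{E ⊆ {1,…,K}} Σ_{H ⊆ E}
  (1-p)^(K-|E|) p^|E| (Π_{j∈H} v_j)(Π_{j∈E∖H}(1-v_j)) · W2 … m ([P11(|H|), τ(v_Ē), P01(|E|-|H|)])`. -/
noncomputable def W2 (N K : ℕ) (β p p01 p11 : ℝ) : ℕ → (Fin N → ℝ) → ℝ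
  | 0, v => p * ∑ i ∈ sched N K, v i
  | m + 1, v => p * ∑ i ∈ sched N K, v i +
      β * ∑ E ∈ (sched N K).powerset, ∑ H ∈ E.powerset,
        ((1 - p) ^ (K - E.card) * p ^ E.card * (∏ j ∈ H, v j) * (∏ j ∈ E \ H, (1 - v j))) *
          W2 N K β p p01 p11 m (nextVec2 N p01 p11 E H v)

/-- The value function of a scheduling policy in the batteryless model, indexed by
remaining time: `V2 … m s` is `V^π_n(s)` with `m = T - n` slots remaining;
`V^π_T(s) = p·Σ_{i ∈ π_T(s)} s_i` and
`V^π_n(s) = p·Σ_{i ∈ π_n(s)} s_i + β·Σ_{E ⊆ π_n(s)} Σ_{H ⊆ E}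
  (1-p)^(K-|E|) p^|E| (Π_{j∈H} s_j)(Π_{j∈E∖H}(1-s_j)) · V^π_{n+1}(s')`,
where `s'_i = p11` for `i ∈ H` (active, found harvesting), `s'_i = p01` for `i ∈ E ∖ H`
(active, found non-harvesting) and `s'_i = τ(s_i) = (p11-p01)·s_i + p01` for `i ∉ E`. -/
noncomputable def V2 (N K T : ℕ) (β p p01 p11 : ℝ)
    (pol : ℕ → (Fin N → ℝ) → Finset (Fin N)) : ℕ → (Fin N → ℝ) → ℝ
  | 0, s => p * ∑ i ∈ pol T s, s i
  | m + 1, s => p * ∑ i ∈ pol (T - (m + 1)) s, s i +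
      β * ∑ E ∈ (pol (T - (m + 1)) s).powerset, ∑ H ∈ E.powerset,
        ((1 - p) ^ (K - E.card) * p ^ E.card * (∏ j ∈ H, s j) * (∏ j ∈ E \ H, (1 - s j))) *
          V2 N K T β p p01 p11 pol m
            (fun i => if i ∈ H then p11 else if i ∈ E then p01 else (p11 - p01) * s i + p01)

/-- Expectation of `Φ a m b` when every entry `x` of a list is independently inactive with
probability `1 - p` (contributing `τ x` to `m`), active and harvesting with probability `p * x`
(counted by `a`), or active and not harvesting with probability `p * (1 - x)` (counted by `b`). -/
noncomputable def observe (p : ℝ) (τ : ℝ → ℝ) : List ℝ → (ℕ → List ℝ → ℕ → ℝ) → ℝ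
  | [], Φ => Φ 0 [] 0
  | x :: l, Φ => (1 - p) * observe p τ l (fun a m b => Φ a (τ x :: m) b) +
      p * x * observe p τ l (fun a m b => Φ (a + 1) m b) +
      p * (1 - x) * observe p τ l (fun a m b => Φ a m (b + 1))

/-- The belief update of an unobserved coordinate. -/
def updateBelief (p01 p11 x : ℝ) : ℝ := (p11 - p01) * x + p01

/-- The one-step operator of the list-based pseudo value functions. -/
noncomputable def bellman (K : ℕ) (β p p01 p11 : ℝ) (G : List ℝ → ℝ) (l : List ℝ) : ℝ :=
  p * (l.take K).sum + β * observe p (updateBelief p01 p11) (l.take K) (fun a m b =>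
    G (List.replicate a p11 ++ (m ++ ((l.drop K).map (updateBelief p01 p11) ++
      List.replicate b p01))))

/-- The pseudo value functions on lists, with `m` slots remaining in total. -/
noncomputable def listValue (K : ℕ) (β p p01 p11 : ℝ) : ℕ → List ℝ → ℝ
  | 0, _ => 0
  | m + 1, l => bellman K β p p01 p11 (listValue K β p p01 p11 m) l

/-- Moving the larger of two adjacent entries to the front does not decrease `G`. -/
def SwapMono (G : List ℝ → ℝ) : Prop :=
  ∀ (l₁ : List ℝ) (x y : ℝ) (l₂ : List ℝ), (∀ t ∈ l₁ ++ x :: y :: l₂, t ∈ Set.Icc (0 : ℝ) 1) →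
    y ≤ x → G (l₁ ++ y :: x :: l₂) ≤ G (l₁ ++ x :: y :: l₂)

/-- `G` is symmetric in the first `K` entries. -/
def PrefixSymm (K : ℕ) (G : List ℝ → ℝ) : Prop :=
  ∀ l l' r : List ℝ, l.Perm l' → l.length ≤ K → G (l ++ r) = G (l' ++ r)

/-- `f` is an affine function of a real variable. -/
def IsAffineFun (f : ℝ → ℝ) : Prop := ∃ c d : ℝ, ∀ x, f x = c + d * x

/-- `G` is affine in every entry. -/
def CoordAffine (G : List ℝ → ℝ) : Prop :=
  ∀ l₁ l₂ : List ℝ, IsAffineFun (fun x => G (l₁ ++ x :: l₂))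

/-- Moving the last entry to the front costs at most `1`. -/
def RotBound (G : List ℝ → ℝ) : Prop :=
  ∀ (x : ℝ) (l : List ℝ), (∀ t ∈ x :: l, t ∈ Set.Icc (0 : ℝ) 1) → G (l ++ [x]) ≤ 1 + G (x :: l)

/-- Observing the larger of two beliefs is at least as good as observing the smaller. -/
def ExchangeMono (β p01 p11 : ℝ) (G : List ℝ → ℝ) : Prop :=
  ∀ (l₁ l₂ : List ℝ) (x y : ℝ), (∀ t ∈ l₁ ++ l₂, t ∈ Set.Icc p01 p11) →
    0 ≤ y → y ≤ x → x ≤ 1 →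
    y + β * (y * G (p11 :: (l₁ ++ updateBelief p01 p11 x :: l₂)) +
        (1 - y) * G (l₁ ++ updateBelief p01 p11 x :: (l₂ ++ [p01]))) ≤
      x + β * (x * G (p11 :: (l₁ ++ updateBelief p01 p11 y :: l₂)) +
        (1 - x) * G (l₁ ++ updateBelief p01 p11 y :: (l₂ ++ [p01])))

section Observe

variable {p : ℝ} {τ : ℝ → ℝ}

lemma observe_congr {l : List ℝ} : ∀ {Φ Ψ : ℕ → List ℝ → ℕ → ℝ},
    (∀ a m b, m.Sublist (l.map τ) → a + m.length + b = l.length → Φ a m b = Ψ a m b) →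
    observe p τ l Φ = observe p τ l Ψ := by
  induction l with
  | nil => intro Φ Ψ h; exact h 0 [] 0 (by simp) (by simp)
  | cons x l ih =>
    intro Φ Ψ h
    simp only [observe]
    rw [ih (Φ := fun a m b => Φ a (τ x :: m) b) (Ψ := fun a m b => Ψ a (τ x :: m) b),
      ih (Φ := fun a m b => Φ (a + 1) m b) (Ψ := fun a m b => Ψ (a + 1) m b),
      ih (Φ := fun a m b => Φ a m (b + 1)) (Ψ := fun a m b => Ψ a m (b + 1))]
    · intro a m b hm hl
      exact h _ _ _ (hm.cons _) (by simp; omega)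
    · intro a m b hm hl
      exact h _ _ _ (hm.cons _) (by simp; omega)
    · intro a m b hm hl
      exact h _ _ _ (hm.cons_cons _) (by simp; omega)

lemma observe_mono (hp0 : 0 ≤ p) (hp1 : p ≤ 1) {l : List ℝ} :
    (∀ x ∈ l, x ∈ Set.Icc (0 : ℝ) 1) → ∀ {Φ Ψ : ℕ → List ℝ → ℕ → ℝ},
    (∀ a m b, m.Sublist (l.map τ) → a + m.length + b = l.length → Φ a m b ≤ Ψ a m b) →
    observe p τ l Φ ≤ observe p τ l Ψ := by
  induction l with
  | nil => intro _ Φ Ψ h; exact h 0 [] 0 (by simp) (by simp)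
  | cons x l ih =>
    intro hl Φ Ψ h
    have hx := hl x (by simp)
    have hl' : ∀ y ∈ l, y ∈ Set.Icc (0 : ℝ) 1 := fun y hy => hl y (by simp [hy])
    simp only [observe]
    refine add_le_add (add_le_add ?_ ?_) ?_
    · refine mul_le_mul_of_nonneg_left (ih hl' fun a m b hm hl => ?_) (by linarith)
      exact h _ _ _ (hm.cons_cons _) (by simp; omega)
    · refine mul_le_mul_of_nonneg_left (ih hl' fun a m b hm hl => ?_) (mul_nonneg hp0 hx.1)
      exact h _ _ _ (hm.cons _) (by simp; omega)
    · refine mul_le_mul_of_nonneg_left (ih hl' fun a m b hm hl => ?_)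
        (mul_nonneg hp0 (by linarith [hx.2]))
      exact h _ _ _ (hm.cons _) (by simp; omega)

lemma observe_add {l : List ℝ} : ∀ {Φ Ψ : ℕ → List ℝ → ℕ → ℝ},
    observe p τ l (fun a m b => Φ a m b + Ψ a m b) = observe p τ l Φ + observe p τ l Ψ := by
  induction l with
  | nil => intro Φ Ψ; rfl
  | cons x l ih => intro Φ Ψ; simp only [observe, ih]; ring

lemma observe_mul {l : List ℝ} (c : ℝ) : ∀ {Φ : ℕ → List ℝ → ℕ → ℝ},
    observe p τ l (fun a m b => c * Φ a m b) = c * observe p τ l Φ := by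
  induction l with
  | nil => intro Φ; rfl
  | cons x l ih => intro Φ; simp only [observe, ih]; ring

lemma observe_const {l : List ℝ} (c : ℝ) : observe p τ l (fun _ _ _ => c) = c := by
  induction l with
  | nil => rfl
  | cons x l ih => simp only [observe, ih]; ring

lemma const_add_observe {l : List ℝ} (c : ℝ) {Φ : ℕ → List ℝ → ℕ → ℝ} :
    c + observe p τ l Φ = observe p τ l (fun a m b => c + Φ a m b) := by
  rw [observe_add, observe_const]

lemma observe_concat {l : List ℝ} (x : ℝ) : ∀ {Φ : ℕ → List ℝ → ℕ → ℝ},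
    observe p τ (l ++ [x]) Φ = observe p τ l (fun a m b => (1 - p) * Φ a (m ++ [τ x]) b +
      (p * x * Φ (a + 1) m b + p * (1 - x) * Φ a m (b + 1))) := by
  induction l with
  | nil => intro Φ; simp only [observe, List.nil_append]; ring
  | cons y l ih => intro Φ; simp only [observe, List.cons_append, ih]

lemma observe_perm {l l' : List ℝ} (h : l.Perm l') : ∀ {Φ : ℕ → List ℝ → ℕ → ℝ},
    (∀ a m m' b, m.Perm m' → a + m.length + b = l.length → Φ a m b = Φ a m' b) →
    observe p τ l Φ = observe p τ l' Φ := by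
  induction h with
  | nil => intro Φ _; rfl
  | @cons x l l' h ih =>
    intro Φ hΦ
    simp only [observe]
    rw [ih (Φ := fun a m b => Φ a (τ x :: m) b), ih (Φ := fun a m b => Φ (a + 1) m b),
      ih (Φ := fun a m b => Φ a m (b + 1))]
    · intro a m m' b hm hl
      exact hΦ _ _ _ _ hm (by simp; omega)
    · intro a m m' b hm hl
      exact hΦ _ _ _ _ hm (by simp; omega)
    · intro a m m' b hm hl
      exact hΦ _ _ _ _ (hm.cons _) (by simp; omega)
  | swap x y l =>
    intro Φ hΦ
    simp only [observe]
    have : observe p τ l (fun a m b => Φ a (τ y :: τ x :: m) b) =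
        observe p τ l (fun a m b => Φ a (τ x :: τ y :: m) b) :=
      observe_congr fun a m b _ hl => hΦ _ _ _ _ (List.Perm.swap _ _ _) (by simp; omega)
    rw [this]
    ring
  | trans h₁ _ ih₁ ih₂ =>
    intro Φ hΦ
    rw [ih₁ hΦ, ih₂]
    intro a m m' b hm hl
    exact hΦ _ _ _ _ hm (by rw [hl, h₁.length_eq])

end Observe

section Affine

variable {f g : ℝ → ℝ}

lemma IsAffineFun.add (hf : IsAffineFun f) (hg : IsAffineFun g) :
    IsAffineFun (fun x => f x + g x) := by
  obtain ⟨c, d, h⟩ := hf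
  obtain ⟨c', d', h'⟩ := hg
  exact ⟨c + c', d + d', fun x => by simp only [h, h']; ring⟩

lemma IsAffineFun.const_mul (hf : IsAffineFun f) (r : ℝ) : IsAffineFun (fun x => r * f x) := by
  obtain ⟨c, d, h⟩ := hf
  exact ⟨r * c, r * d, fun x => by simp only [h]; ring⟩

lemma IsAffineFun.comp_updateBelief (hf : IsAffineFun f) (p01 p11 : ℝ) :
    IsAffineFun (fun x => f (updateBelief p01 p11 x)) := by
  obtain ⟨c, d, h⟩ := hf
  exact ⟨c + d * p01, d * (p11 - p01), fun x => by simp only [h, updateBelief]; ring⟩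

lemma IsAffineFun.eq_interp (hf : IsAffineFun f) (x : ℝ) :
    f x = (1 - x) * f 0 + x * f 1 := by
  obtain ⟨c, d, h⟩ := hf
  simp only [h]; ring

lemma IsAffineFun.le_of_endpoints (hf : IsAffineFun f) (hg : IsAffineFun g) (h0 : f 0 ≤ g 0)
    (h1 : f 1 ≤ g 1) {x : ℝ} (hx : x ∈ Set.Icc (0 : ℝ) 1) : f x ≤ g x := by
  rw [hf.eq_interp x, hg.eq_interp x]
  exact add_le_add (mul_le_mul_of_nonneg_left h0 (by linarith [hx.2]))
    (mul_le_mul_of_nonneg_left h1 hx.1)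

lemma isAffineFun_observe {p : ℝ} {τ : ℝ → ℝ} {l : List ℝ} : ∀ {Φ : ℝ → ℕ → List ℝ → ℕ → ℝ},
    (∀ a m b, IsAffineFun (fun x => Φ x a m b)) →
    IsAffineFun (fun x => observe p τ l (Φ x)) := by
  induction l with
  | nil => intro Φ h; exact h 0 [] 0
  | cons y l ih =>
    intro Φ h
    simp only [observe]
    exact (((ih fun a m b => h a (τ y :: m) b).const_mul _).add
      ((ih fun a m b => h (a + 1) m b).const_mul _)).add
      ((ih fun a m b => h a m (b + 1)).const_mul _)

lemma isAffineFun_observe_entry {p p01 p11 : ℝ} {l₁ l₂ : List ℝ} :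
    ∀ {Φ : ℕ → List ℝ → ℕ → ℝ},
    (∀ a m₁ m₂ b, IsAffineFun (fun x => Φ a (m₁ ++ x :: m₂) b)) →
    IsAffineFun (fun x => observe p (updateBelief p01 p11) (l₁ ++ x :: l₂) Φ) := by
  induction l₁ with
  | nil =>
    intro Φ h
    simp only [observe, List.nil_append]
    refine (((isAffineFun_observe fun a m b => ?_).const_mul _).add ?_).add ?_
    · exact (h a [] m b).comp_updateBelief p01 p11
    · exact ⟨0, _, fun x => by rw [zero_add, mul_right_comm]⟩
    · generalize observe p (updateBelief p01 p11) l₂ _ = r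
      exact ⟨p * r, -(p * r), fun x => by ring⟩
  | cons y l ih =>
    intro Φ h
    simp only [observe, List.cons_append]
    exact (((ih fun a m₁ m₂ b => h a (_ :: m₁) m₂ b).const_mul _).add
      ((ih fun a m₁ m₂ b => h (a + 1) m₁ m₂ b).const_mul _)).add
      ((ih fun a m₁ m₂ b => h a m₁ m₂ (b + 1)).const_mul _)

end Affine

section SwapMono

variable {G : List ℝ → ℝ}

lemma SwapMono.le_move_front (hG : SwapMono G) {x : ℝ} {r : List ℝ} (l : List ℝ) :
    ∀ q : List ℝ, (∀ t ∈ q ++ x :: (l ++ r), t ∈ Set.Icc (0 : ℝ) 1) → (∀ t ∈ l, t ≤ x) →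
    G (q ++ (l ++ x :: r)) ≤ G (q ++ x :: (l ++ r)) := by
  induction l with
  | nil => intro q _ _; exact le_rfl
  | cons y l ih =>
    intro q hd hx
    have h1 := ih (q ++ [y]) (fun t ht => hd t (by simp at ht ⊢; tauto))
      (fun t ht => hx t (by simp [ht]))
    have h2 := hG q x y (l ++ r) (by simpa using hd) (hx y (by simp))
    simp only [List.append_assoc, List.cons_append, List.nil_append] at h1 h2 ⊢
    exact h1.trans h2

lemma SwapMono.move_front_le (hG : SwapMono G) {x : ℝ} {r : List ℝ} (l : List ℝ) :
    ∀ q : List ℝ, (∀ t ∈ q ++ x :: (l ++ r), t ∈ Set.Icc (0 : ℝ) 1) → (∀ t ∈ l, x ≤ t) →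
    G (q ++ x :: (l ++ r)) ≤ G (q ++ (l ++ x :: r)) := by
  induction l with
  | nil => intro q _ _; exact le_rfl
  | cons y l ih =>
    intro q hd hx
    have h1 := ih (q ++ [y]) (fun t ht => hd t (by simp at ht ⊢; tauto))
      (fun t ht => hx t (by simp [ht]))
    have h2 := hG q y x (l ++ r) (fun t ht => hd t (by simp at ht ⊢; tauto)) (hx y (by simp))
    simp only [List.append_assoc, List.cons_append, List.nil_append] at h1 h2 ⊢
    exact h2.trans h1

lemma SwapMono.le_orderedInsert (hG : SwapMono G) {x : ℝ} (l : List ℝ) :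
    ∀ q : List ℝ, (∀ t ∈ q ++ x :: l, t ∈ Set.Icc (0 : ℝ) 1) →
    G (q ++ x :: l) ≤ G (q ++ l.orderedInsert (· ≥ ·) x) := by
  induction l with
  | nil => intro q _; exact le_rfl
  | cons y l ih =>
    intro q hd
    rw [List.orderedInsert_cons]
    split_ifs with h
    · exact le_rfl
    · have h1 := ih (q ++ [y]) (fun t ht => hd t (by simp at ht ⊢; tauto))
      have h2 := hG q y x l (fun t ht => hd t (by simp at ht ⊢; tauto)) (not_le.mp h).le
      simp only [List.append_assoc, List.cons_append, List.nil_append] at h1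
      exact h2.trans h1

lemma SwapMono.le_insertionSort (hG : SwapMono G) (l : List ℝ) :
    ∀ q : List ℝ, (∀ t ∈ q ++ l, t ∈ Set.Icc (0 : ℝ) 1) →
    G (q ++ l) ≤ G (q ++ l.insertionSort (· ≥ ·)) := by
  induction l with
  | nil => intro q _; exact le_rfl
  | cons x l ih =>
    intro q hd
    have h1 := ih (q ++ [x]) (by simpa using hd)
    simp only [List.append_assoc, List.cons_append, List.nil_append] at h1
    refine h1.trans (hG.le_orderedInsert _ q fun t ht => hd t ?_)
    simpa using ht

lemma insertionSort_eq_of_perm {l l' : List ℝ} (h : l.Perm l') (hs : l'.Pairwise (· ≥ ·)) :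
    l.insertionSort (· ≥ ·) = l' :=
  ((l.perm_insertionSort _).trans h).eq_of_pairwise'
    (l.pairwise_insertionSort _) hs

lemma insertionSort_congr {l l' : List ℝ} (h : l.Perm l') :
    l.insertionSort (· ≥ ·) = l'.insertionSort (· ≥ ·) :=
  insertionSort_eq_of_perm (h.trans (l'.perm_insertionSort _).symm)
    (l'.pairwise_insertionSort _)

lemma SwapMono.le_insertionSort_of_perm (hG : SwapMono G) {l l' : List ℝ} (h : l.Perm l')
    (hd : ∀ t ∈ l, t ∈ Set.Icc (0 : ℝ) 1) : G l ≤ G (l'.insertionSort (· ≥ ·)) := by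
  rw [← insertionSort_congr h]
  exact hG.le_insertionSort l [] hd

end SwapMono

section Bellman

variable {K : ℕ} {β p p01 p11 : ℝ} {G : List ℝ → ℝ}

lemma updateBelief_zero : updateBelief p01 p11 0 = p01 := by simp [updateBelief]

lemma updateBelief_one : updateBelief p01 p11 1 = p11 := by simp [updateBelief]

lemma updateBelief_mono (h : p01 ≤ p11) : Monotone (updateBelief p01 p11) := fun x y hxy => by
  have := mul_le_mul_of_nonneg_left hxy (sub_nonneg.mpr h)
  simp only [updateBelief]; linarith

lemma updateBelief_mem (h : p01 ≤ p11) {x : ℝ} (hx : x ∈ Set.Icc (0 : ℝ) 1) :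
    updateBelief p01 p11 x ∈ Set.Icc p01 p11 := by
  have h0 := updateBelief_mono h hx.1
  have h1 := updateBelief_mono h hx.2
  rw [updateBelief_zero] at h0
  rw [updateBelief_one] at h1
  exact ⟨h0, h1⟩

lemma mem_Icc_of_mem_map_updateBelief (h : p01 ≤ p11) {l : List ℝ}
    (hl : ∀ t ∈ l, t ∈ Set.Icc (0 : ℝ) 1) :
    ∀ t ∈ l.map (updateBelief p01 p11), t ∈ Set.Icc p01 p11 := by
  intro t ht
  obtain ⟨x, hx, rfl⟩ := List.mem_map.mp ht
  exact updateBelief_mem h (hl x hx)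

lemma bellman_append {l : List ℝ} (hl : l.length = K) (r : List ℝ) :
    bellman K β p p01 p11 G (l ++ r) = p * l.sum + β * observe p (updateBelief p01 p11) l
      (fun a m b => G (List.replicate a p11 ++ (m ++ (r.map (updateBelief p01 p11) ++
        List.replicate b p01)))) := by
  rw [bellman, List.take_left' hl, List.drop_left' hl]

lemma PrefixSymm.bellman (hG : PrefixSymm K G) : PrefixSymm K (bellman K β p p01 p11 G) := by
  intro l l' r h hl
  have hperm : (l ++ r.take (K - l.length)).Perm (l' ++ r.take (K - l.length)) := h.append_right _
  simp only [_root_.bellman, List.take_append, List.drop_append, List.take_of_length_le hl,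
    List.take_of_length_le (h.length_eq ▸ hl), List.drop_of_length_le hl,
    List.drop_of_length_le (h.length_eq ▸ hl), ← h.length_eq, hperm.sum_eq, List.nil_append]
  congr 2
  refine observe_perm hperm fun a m m' b hm hlen => ?_
  have := hG (List.replicate a p11 ++ m) (List.replicate a p11 ++ m')
    ((r.drop (K - l.length)).map (updateBelief p01 p11) ++ List.replicate b p01)
    (hm.append_left _) (by simp at hlen ⊢; omega)
  simpa using this

lemma CoordAffine.bellman (hG : CoordAffine G) : CoordAffine (bellman K β p p01 p11 G) := by
  intro l₁ l₂
  rcases le_or_gt K l₁.length with h | h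
  · obtain ⟨A, B, hA, rfl⟩ : ∃ A B, A.length = K ∧ A ++ B = l₁ :=
      ⟨l₁.take K, l₁.drop K, by simpa using h, List.take_append_drop _ _⟩
    simp only [List.append_assoc, bellman_append hA, List.map_append, List.map_cons,
      List.cons_append]
    refine IsAffineFun.add ⟨_, 0, fun x => by rw [zero_mul, add_zero]⟩
      ((isAffineFun_observe fun a m b => ?_).const_mul _)
    have := (hG (List.replicate a p11 ++ (m ++ B.map (updateBelief p01 p11)))
      (l₂.map (updateBelief p01 p11) ++ List.replicate b p01)).comp_updateBelief p01 p11
    simpa only [List.append_assoc] using this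
  · obtain ⟨k, hk⟩ : ∃ k, K - l₁.length = k + 1 := ⟨K - l₁.length - 1, by omega⟩
    simp only [_root_.bellman, List.take_append, List.drop_append, hk, List.take_succ_cons,
      List.drop_succ_cons, List.take_of_length_le h.le, List.drop_of_length_le h.le,
      List.nil_append]
    refine IsAffineFun.add ?_ ((isAffineFun_observe_entry fun a m₁ m₂ b => ?_).const_mul _)
    · refine IsAffineFun.const_mul ⟨l₁.sum + (l₂.take k).sum, 1, fun x => ?_⟩ _
      simp; ring
    · have := hG (List.replicate a p11 ++ m₁) (m₂ ++ ((l₂.drop k).map (updateBelief p01 p11) ++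
        List.replicate b p01))
      simpa only [List.append_assoc, List.cons_append] using this

end Bellman

section Exchange

variable {K : ℕ} {β p p01 p11 : ℝ} {G : List ℝ → ℝ}

lemma RotBound.le_move (hR : RotBound G) (hS : SwapMono G) {c : ℝ} (hc : 0 ≤ c) {l₁ l₂ : List ℝ}
    (hd : ∀ t ∈ l₁ ++ l₂, t ∈ Set.Icc c 1) (hc1 : c ≤ 1) :
    G (l₁ ++ (l₂ ++ [c])) ≤ 1 + G (l₁ ++ c :: l₂) := by
  have hd' : ∀ t ∈ c :: (l₁ ++ l₂), t ∈ Set.Icc (0 : ℝ) 1 := by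
    intro t ht
    rcases List.mem_cons.mp ht with rfl | ht
    · exact ⟨hc, hc1⟩
    · exact ⟨hc.trans (hd t ht).1, (hd t ht).2⟩
  have h1 := hR c (l₁ ++ l₂) hd'
  have h2 := hS.move_front_le l₁ [] hd' (fun t ht => (hd t (by simp [ht])).1)
  simp only [List.append_assoc, List.nil_append] at h1 h2
  linarith

lemma exchange_of_affine {f g : ℝ → ℝ} (hf : IsAffineFun f) (hg : IsAffineFun g)
    (h : g 1 ≤ 1 + f 0) (hβ0 : 0 ≤ β) (hβ1 : β ≤ 1) {x y : ℝ} (hyx : y ≤ x) :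
    y + β * (y * f x + (1 - y) * g x) ≤ x + β * (x * f y + (1 - x) * g y) := by
  obtain ⟨c, d, hf⟩ := hf
  obtain ⟨c', d', hg⟩ := hg
  simp only [hf, hg] at h ⊢
  have h1 : 0 ≤ 1 - β * (c' + d' * 1 - (c + d * 0)) := by
    nlinarith [mul_le_mul_of_nonneg_left h hβ0]
  nlinarith [mul_nonneg (sub_nonneg.mpr hyx) h1]

lemma CoordAffine.exchangeMono (hA : CoordAffine G) (hS : SwapMono G) (hR : RotBound G)
    (hβ0 : 0 ≤ β) (hβ1 : β ≤ 1) (h0 : 0 ≤ p01) (h01 : p01 ≤ p11) (h1 : p11 ≤ 1) :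
    ExchangeMono β p01 p11 G := by
  intro l₁ l₂ x y hd _ hyx _
  refine exchange_of_affine (f := fun t => G (p11 :: (l₁ ++ updateBelief p01 p11 t :: l₂)))
    (g := fun t => G (l₁ ++ updateBelief p01 p11 t :: (l₂ ++ [p01])))
    ((hA (p11 :: l₁) l₂).comp_updateBelief p01 p11)
    ((hA l₁ (l₂ ++ [p01])).comp_updateBelief p01 p11) ?_ hβ0 hβ1 hyx
  simp only [updateBelief_zero, updateBelief_one]
  have e1 := hR.le_move hS h0 (l₁ := l₁ ++ [p11]) (l₂ := l₂) (fun t ht => by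
    rcases (by simpa [or_left_comm] using ht : t = p11 ∨ t ∈ l₁ ∨ t ∈ l₂) with rfl | ht
    · exact ⟨h01, h1⟩
    · exact ⟨(hd t (by simpa using ht)).1, (hd t (by simpa using ht)).2.trans h1⟩) (h01.trans h1)
  have e2 := hS.le_move_front (x := p11) (r := p01 :: l₂) l₁ [] (fun t ht => by
    rcases (by simpa [or_left_comm] using ht : t = p11 ∨ t = p01 ∨ t ∈ l₁ ∨ t ∈ l₂)
      with rfl | rfl | ht
    · exact ⟨h0.trans h01, h1⟩
    · exact ⟨h0, h01.trans h1⟩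
    · exact ⟨h0.trans (hd t (by simpa using ht)).1, (hd t (by simpa using ht)).2.trans h1⟩)
    (fun t ht => (hd t (by simp [ht])).2)
  simp only [List.append_assoc, List.cons_append, List.nil_append] at e1 e2
  linarith

lemma ExchangeMono.comp_insertionSort (hE : ExchangeMono β p01 p11 G) (hS : SwapMono G)
    (hβ0 : 0 ≤ β) (h0 : 0 ≤ p01) (h01 : p01 ≤ p11) (h1 : p11 ≤ 1) :
    ExchangeMono β p01 p11 (fun l => G (l.insertionSort (· ≥ ·))) := by
  intro l₁ l₂ x y hd hy hyx hx
  have hxm := updateBelief_mem h01 (x := x) ⟨hy.trans hyx, hx⟩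
  have hym := updateBelief_mem h01 (x := y) ⟨hy, hyx.trans hx⟩
  obtain ⟨q, r, hqr⟩ := List.append_of_mem
    (show updateBelief p01 p11 x ∈ (l₁ ++ updateBelief p01 p11 x :: l₂).insertionSort (· ≥ ·) by
      simp)
  have hs : (q ++ updateBelief p01 p11 x :: r).Pairwise (· ≥ ·) := by
    rw [← hqr]; exact List.pairwise_insertionSort _ _
  have hp : (l₁ ++ updateBelief p01 p11 x :: l₂).Perm (q ++ updateBelief p01 p11 x :: r) := by
    rw [← hqr]; exact (List.perm_insertionSort _ _).symm
  have hp' : (l₁ ++ l₂).Perm (q ++ r) :=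
    ((List.perm_middle.symm.trans hp).trans List.perm_middle).cons_inv
  have hd' : ∀ t ∈ q ++ r, t ∈ Set.Icc p01 p11 := fun t ht => hd t (hp'.mem_iff.mpr ht)
  have hpy : (l₁ ++ updateBelief p01 p11 y :: l₂).Perm (q ++ updateBelief p01 p11 y :: r) :=
    (List.perm_middle.trans (hp'.cons _)).trans List.perm_middle.symm
  have hdx : ∀ t ∈ q ++ updateBelief p01 p11 x :: r, t ∈ Set.Icc p01 p11 := by
    intro t ht
    rcases (by simpa [or_left_comm] using ht : t = updateBelief p01 p11 x ∨ t ∈ q ∨ t ∈ r)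
      with rfl | ht
    · exact hxm
    · exact hd' t (by simpa using ht)
  have hdy : ∀ t ∈ q ++ updateBelief p01 p11 y :: r, t ∈ Set.Icc (0 : ℝ) 1 := by
    intro t ht
    rcases (by simpa [or_left_comm] using ht : t = updateBelief p01 p11 y ∨ t ∈ q ∨ t ∈ r)
      with rfl | ht
    · exact ⟨h0.trans hym.1, hym.2.trans h1⟩
    · have := hd' t (by simpa using ht)
      exact ⟨h0.trans this.1, this.2.trans h1⟩
  have e1 : (p11 :: (l₁ ++ updateBelief p01 p11 x :: l₂)).insertionSort (· ≥ ·) =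
      p11 :: (q ++ updateBelief p01 p11 x :: r) :=
    insertionSort_eq_of_perm (hp.cons _) (List.pairwise_cons.mpr ⟨fun t ht => (hdx t ht).2, hs⟩)
  have e2 : (l₁ ++ updateBelief p01 p11 x :: (l₂ ++ [p01])).insertionSort (· ≥ ·) =
      q ++ updateBelief p01 p11 x :: (r ++ [p01]) := by
    refine insertionSort_eq_of_perm ?_ ?_
    · simpa using hp.append_right [p01]
    · have : ((q ++ updateBelief p01 p11 x :: r) ++ [p01]).Pairwise (· ≥ ·) :=
        List.pairwise_append.mpr ⟨hs, by simp, fun t ht u hu => by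
          rw [List.mem_singleton.mp hu]; exact (hdx t ht).1⟩
      simpa using this
  have e3 := hS.le_insertionSort_of_perm (hpy.cons p11).symm (fun t ht => by
    rcases List.mem_cons.mp ht with rfl | ht
    · exact ⟨h0.trans h01, h1⟩
    · exact hdy t ht)
  have e4 := hS.le_insertionSort_of_perm (hpy.append_right [p01]).symm (fun t ht => by
    rcases List.mem_append.mp ht with ht | ht
    · exact hdy t ht
    · rw [List.mem_singleton.mp ht]; exact ⟨h0, h01.trans h1⟩)
  simp only [List.append_assoc, List.cons_append] at e4
  have key := hE q r x y hd' hy hyx hx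
  simp only [e1, e2]
  refine key.trans ?_
  have hx0 := hy.trans hyx
  gcongr

lemma SwapMono.bellman (hS : SwapMono G) (hsym : PrefixSymm K G) (hE : ExchangeMono β p01 p11 G)
    (hβ0 : 0 ≤ β) (hp0 : 0 ≤ p) (hp1 : p ≤ 1) (h0 : 0 ≤ p01) (h01 : p01 ≤ p11) (h1 : p11 ≤ 1) :
    SwapMono (bellman K β p p01 p11 G) := by
  intro l₁ x y l₂ hd hyx
  have hmem : ∀ {l : List ℝ} {m : List ℝ}, m.Sublist (l.map (updateBelief p01 p11)) →
      (∀ t ∈ l, t ∈ Set.Icc (0 : ℝ) 1) → ∀ t ∈ m, t ∈ Set.Icc p01 p11 := fun hm hl t ht =>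
    mem_Icc_of_mem_map_updateBelief h01 hl t (hm.subset ht)
  have hx := hd x (by simp)
  have hy := hd y (by simp)
  have hd₁ : ∀ t ∈ l₁, t ∈ Set.Icc (0 : ℝ) 1 := fun t ht => hd t (by simp [ht])
  have hd₂ : ∀ t ∈ l₂, t ∈ Set.Icc (0 : ℝ) 1 := fun t ht => hd t (by simp [ht])
  have hup : ∀ {t : ℝ}, t ∈ Set.Icc p01 p11 → t ∈ Set.Icc (0 : ℝ) 1 := fun ht =>
    ⟨h0.trans ht.1, ht.2.trans h1⟩
  have hxm := updateBelief_mem h01 hx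
  have hym := updateBelief_mem h01 hy
  have hrep : ∀ {k : ℕ} {c t : ℝ}, t ∈ List.replicate k c → t = c := List.eq_of_mem_replicate
  have h11 : p11 ∈ Set.Icc p01 p11 := ⟨h01, le_rfl⟩
  have h10 : p01 ∈ Set.Icc p01 p11 := ⟨le_rfl, h01⟩
  rcases lt_trichotomy (l₁.length + 1) K with h | h | h
  · have := hsym.bellman (β := β) (p := p) (p01 := p01) (p11 := p11) (l₁ ++ [y, x])
      (l₁ ++ [x, y]) l₂ ((List.Perm.swap _ _ _).append_left _) (by simp; omega)
    simpa using this.le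
  · have hy' : l₁ ++ y :: x :: l₂ = (l₁ ++ [y]) ++ (x :: l₂) := by simp
    have hx' : l₁ ++ x :: y :: l₂ = (l₁ ++ [x]) ++ (y :: l₂) := by simp
    rw [hx', hy', bellman_append (by simpa using h), bellman_append (by simpa using h),
      observe_concat, observe_concat]
    simp only [List.sum_append, List.sum_singleton, List.map_cons, List.cons_append,
      List.append_assoc, List.nil_append]
    rw [← observe_mul, ← observe_mul, mul_add, mul_add, add_assoc, add_assoc,
      add_le_add_iff_left, const_add_observe, const_add_observe]
    refine observe_mono hp0 hp1 hd₁ fun a m b hm _ => ?_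
    have hm' := hmem hm hd₁
    have hl₂' := mem_Icc_of_mem_map_updateBelief h01 hd₂
    have s := hS (List.replicate a p11 ++ m) (updateBelief p01 p11 x) (updateBelief p01 p11 y)
      (l₂.map (updateBelief p01 p11) ++ List.replicate b p01) (fun t ht => by
        apply hup
        simp only [List.mem_append, List.mem_cons] at ht
        rcases ht with (ht | ht) | rfl | rfl | ht | ht
        · rwa [hrep ht]
        · exact hm' t ht
        · exact hxm
        · exact hym
        · exact hl₂' t ht
        · rwa [hrep ht]) (updateBelief_mono h01 hyx)
    have e := hE (List.replicate a p11 ++ m)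
      (l₂.map (updateBelief p01 p11) ++ List.replicate b p01) x y (fun t ht => by
        simp only [List.mem_append] at ht
        rcases ht with (ht | ht) | ht | ht
        · rwa [hrep ht]
        · exact hm' t ht
        · exact hl₂' t ht
        · rwa [hrep ht]) hy.1 hyx hx.2
    simp only [List.append_assoc, List.replicate_succ' (n := b)] at s e ⊢
    simp only [List.replicate_succ (n := a), List.cons_append]
    have s' := mul_le_mul_of_nonneg_left s (mul_nonneg hβ0 (sub_nonneg.mpr hp1))
    have e' := mul_le_mul_of_nonneg_left e hp0
    linarith
  · obtain ⟨A, B, hA, rfl⟩ : ∃ A B, A.length = K ∧ A ++ B = l₁ :=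
      ⟨l₁.take K, l₁.drop K, by simp; omega, List.take_append_drop _ _⟩
    rw [List.append_assoc, List.append_assoc, bellman_append hA, bellman_append hA]
    have hdA : ∀ t ∈ A, t ∈ Set.Icc (0 : ℝ) 1 := fun t ht => hd₁ t (by simp [ht])
    have hdB : ∀ t ∈ B, t ∈ Set.Icc (0 : ℝ) 1 := fun t ht => hd₁ t (by simp [ht])
    gcongr
    refine observe_mono hp0 hp1 hdA fun a m b hm _ => ?_
    have s := hS (List.replicate a p11 ++ (m ++ B.map (updateBelief p01 p11)))
      (updateBelief p01 p11 x) (updateBelief p01 p11 y)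
      (l₂.map (updateBelief p01 p11) ++ List.replicate b p01) (fun t ht => by
        apply hup
        simp only [List.mem_append, List.mem_cons] at ht
        rcases ht with (ht | ht | ht) | rfl | rfl | ht | ht
        · rwa [hrep ht]
        · exact hmem hm hdA t ht
        · exact mem_Icc_of_mem_map_updateBelief h01 hdB t ht
        · exact hxm
        · exact hym
        · exact mem_Icc_of_mem_map_updateBelief h01 hd₂ t ht
        · rwa [hrep ht]) (updateBelief_mono h01 hyx)
    simpa using s

lemma RotBound.bellman (hK : 1 ≤ K) (hR : RotBound G) (hS : SwapMono G) (hsym : PrefixSymm K G)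
    (hA : CoordAffine G) (hβ0 : 0 ≤ β) (hβ1 : β ≤ 1) (hp0 : 0 ≤ p) (hp1 : p ≤ 1)
    (h0 : 0 ≤ p01) (h01 : p01 ≤ p11) (h1 : p11 ≤ 1) :
    RotBound (bellman K β p p01 p11 G) := by
  intro x l hd
  have hl : ∀ t ∈ l, t ∈ Set.Icc (0 : ℝ) 1 := fun t ht => hd t (by simp [ht])
  have hx : x ∈ Set.Icc (0 : ℝ) 1 := hd x (by simp)
  have hS' := hS.bellman (K := K) hsym (hA.exchangeMono hS hR hβ0 hβ1 h0 h01 h1) hβ0 hp0 hp1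
    h0 h01 h1
  have hA' := hA.bellman (K := K) (β := β) (p := p) (p01 := p01) (p11 := p11)
  rcases Nat.lt_or_ge l.length K with h | h
  · have := hsym.bellman (β := β) (p := p) (p01 := p01) (p11 := p11) (l ++ [x]) (x :: l) []
      (List.perm_append_singleton _ _) (by simp; omega)
    simp only [List.append_nil] at this
    linarith
  refine IsAffineFun.le_of_endpoints
    (f := fun x => _root_.bellman K β p p01 p11 G (l ++ [x]))
    (g := fun x => 1 + _root_.bellman K β p p01 p11 G (x :: l)) (hA' l [])
    (IsAffineFun.add ⟨1, 0, fun x => by simp⟩ (hA' [] l)) ?_ ?_ hx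
  · obtain ⟨C, z, D, hC, rfl⟩ : ∃ C z D, C.length + 1 = K ∧ l = C ++ z :: D := by
      have hlt : K - 1 < l.length := by omega
      refine ⟨l.take (K - 1), l[K - 1], l.drop (K - 1 + 1), by simp; omega, ?_⟩
      rw [← List.drop_eq_getElem_cons hlt, List.take_append_drop]
    have hz := hl z (by simp)
    have hdC : ∀ t ∈ C, t ∈ Set.Icc (0 : ℝ) 1 := fun t ht => hl t (by simp [ht])
    have hdD : ∀ t ∈ D, t ∈ Set.Icc (0 : ℝ) 1 := fun t ht => hl t (by simp [ht])
    have e1 : (C ++ z :: D) ++ [0] = (C ++ [z]) ++ (D ++ [0]) := by simp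
    have e2 : (0 : ℝ) :: (C ++ z :: D) = (0 :: C) ++ (z :: D) := by simp
    simp only [e1, e2]
    rw [bellman_append (by simpa using hC), bellman_append (by simpa using hC), observe_concat,
      observe]
    simp only [← observe_mul, ← observe_add]
    have hpC : p * (C ++ [z]).sum = p * C.sum + p * z := by simp; ring
    have hpC' : p * ((0 : ℝ) :: C).sum = p * C.sum := by simp
    rw [hpC, hpC', add_assoc, add_left_comm 1, add_le_add_iff_left, const_add_observe,
      const_add_observe]
    refine observe_mono hp0 hp1 hdC fun a m b hm hlen => ?_
    have hm' : ∀ t ∈ m, t ∈ Set.Icc p01 p11 := fun t ht =>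
      mem_Icc_of_mem_map_updateBelief h01 hdC t (hm.subset ht)
    have hD' := mem_Icc_of_mem_map_updateBelief h01 hdD
    have hzm := updateBelief_mem h01 hz
    simp only [List.map_append, List.map_cons, List.map_nil, updateBelief_zero, mul_zero,
      zero_mul, add_zero, sub_zero, mul_one, List.append_assoc, List.cons_append, List.nil_append]
    set R := D.map (updateBelief p01 p11)
    have hrep : p01 :: List.replicate b p01 = List.replicate b p01 ++ [p01] := by
      rw [← List.replicate_succ, List.replicate_succ']
    have hrep' : p01 :: List.replicate (b + 1) p01 = List.replicate (b + 1) p01 ++ [p01] := by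
      rw [← List.replicate_succ, List.replicate_succ']
    have hup : ∀ {t : ℝ}, t ∈ Set.Icc p01 p11 → t ∈ Set.Icc p01 (1 : ℝ) := fun ht =>
      ⟨ht.1, ht.2.trans h1⟩
    have i1 := hR.le_move hS h0 (l₁ := List.replicate a p11)
      (l₂ := m ++ updateBelief p01 p11 z :: (R ++ List.replicate b p01)) (fun t ht => by
        apply hup
        simp only [List.mem_append, List.mem_cons] at ht
        rcases ht with ht | ht | rfl | ht | ht
        · rw [List.eq_of_mem_replicate ht]; exact ⟨h01, le_rfl⟩
        · exact hm' t ht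
        · exact hzm
        · exact hD' t ht
        · rw [List.eq_of_mem_replicate ht]; exact ⟨le_rfl, h01⟩) (h01.trans h1)
    have i2 := hR.le_move hS h0 (l₁ := List.replicate a p11 ++ m)
      (l₂ := R ++ List.replicate (b + 1) p01) (fun t ht => by
        apply hup
        simp only [List.mem_append] at ht
        rcases ht with (ht | ht) | ht | ht
        · rw [List.eq_of_mem_replicate ht]; exact ⟨h01, le_rfl⟩
        · exact hm' t ht
        · exact hD' t ht
        · rw [List.eq_of_mem_replicate ht]; exact ⟨le_rfl, h01⟩) (h01.trans h1)
    have i3 := ((hA (List.replicate a p11 ++ m)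
      (R ++ List.replicate (b + 1) p01)).comp_updateBelief p01 p11).eq_interp z
    simp only [updateBelief_zero, updateBelief_one] at i3
    have i4 := hsym (List.replicate a p11 ++ (m ++ [p11])) (List.replicate (a + 1) p11 ++ m)
      (R ++ List.replicate (b + 1) p01) (by
        rw [List.replicate_succ', List.append_assoc]
        exact (List.perm_append_singleton _ _).append_left _) (by simp; omega)
    simp only [List.append_assoc, List.cons_append, List.nil_append] at i1 i2 i3 i4
    rw [i3, i4, hrep', hrep]
    have hb : List.replicate (b + 1) p01 = List.replicate b p01 ++ [p01] := List.replicate_succ'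
    rw [← hb] at i1 ⊢
    have hp1' := sub_nonneg.mpr hp1
    have hz' := sub_nonneg.mpr hz.2
    have j1 := mul_le_mul_of_nonneg_left i1 (mul_nonneg hβ0 hp1')
    have j2 := mul_le_mul_of_nonneg_left i2 (mul_nonneg hβ0 (mul_nonneg hp0 hz'))
    have j3 := mul_le_mul_of_nonneg_right hβ1 hp1'
    have j4 := mul_le_mul_of_nonneg_right hβ1 (mul_nonneg hp0 hz')
    linarith
  · have := hS'.le_move_front (x := 1) (r := []) l [] (by simpa using hl) (fun t ht => (hl t ht).2)
    simp only [List.nil_append, List.append_nil] at this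
    linarith

end Exchange

section ListValue

variable {K : ℕ} {β p p01 p11 : ℝ}

lemma listValue_properties (hK : 1 ≤ K) (hβ0 : 0 ≤ β) (hβ1 : β ≤ 1) (hp0 : 0 ≤ p) (hp1 : p ≤ 1)
    (h0 : 0 ≤ p01) (h01 : p01 ≤ p11) (h1 : p11 ≤ 1) (m : ℕ) :
    SwapMono (listValue K β p p01 p11 m) ∧ RotBound (listValue K β p p01 p11 m) ∧
      PrefixSymm K (listValue K β p p01 p11 m) ∧ CoordAffine (listValue K β p p01 p11 m) := by
  induction m with
  | zero =>
    refine ⟨fun _ _ _ _ _ _ => le_rfl, fun _ _ _ => ?_, fun _ _ _ _ _ => rfl,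
      fun _ _ => ⟨0, 0, fun x => by simp [listValue]⟩⟩
    simp [listValue]
  | succ m ih =>
    obtain ⟨hS, hR, hsym, hA⟩ := ih
    exact ⟨hS.bellman hsym (hA.exchangeMono hS hR hβ0 hβ1 h0 h01 h1) hβ0 hp0 hp1 h0 h01 h1,
      hR.bellman hK hS hsym hA hβ0 hβ1 hp0 hp1 h0 h01 h1, hsym.bellman, hA.bellman⟩

/-- One step with an arbitrary scheduled set `l`, followed by the myopic policy, is dominated by
the myopic policy. -/
lemma bellman_le_listValue (hK : 1 ≤ K) (hβ0 : 0 ≤ β) (hβ1 : β ≤ 1) (hp0 : 0 ≤ p) (hp1 : p ≤ 1)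
    (h0 : 0 ≤ p01) (h01 : p01 ≤ p11) (h1 : p11 ≤ 1) (m : ℕ) {l : List ℝ}
    (hl : ∀ t ∈ l, t ∈ Set.Icc (0 : ℝ) 1) :
    bellman K β p p01 p11 (fun q => listValue K β p p01 p11 m (q.insertionSort (· ≥ ·))) l ≤
      listValue K β p p01 p11 (m + 1) (l.insertionSort (· ≥ ·)) := by
  obtain ⟨hS, hR, hsym, hA⟩ := listValue_properties (K := K) hK hβ0 hβ1 hp0 hp1 h0 h01 h1 m
  have hcongr : ∀ {q q' : List ℝ}, q.Perm q' →
      listValue K β p p01 p11 m (q.insertionSort (· ≥ ·)) =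
        listValue K β p p01 p11 m (q'.insertionSort (· ≥ ·)) := fun h => by
    rw [insertionSort_congr h]
  have hS' : SwapMono (fun q => listValue K β p p01 p11 m (q.insertionSort (· ≥ ·))) :=
    fun l₁ x y l₂ _ _ => (hcongr ((List.Perm.swap _ _ _).append_left _)).le
  have hE := (hA.exchangeMono hS hR hβ0 hβ1 h0 h01 h1).comp_insertionSort hS hβ0 h0 h01 h1
  have hB := hS'.bellman (K := K) (fun q q' r h _ => hcongr (h.append_right r)) hE hβ0 hp0 hp1
    h0 h01 h1
  refine (hB.le_insertionSort l [] hl).trans (le_of_eq ?_)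
  have hs := l.pairwise_insertionSort (· ≥ ·)
  have hd : ∀ t ∈ l.insertionSort (· ≥ ·), t ∈ Set.Icc (0 : ℝ) 1 := fun t ht =>
    hl t ((l.perm_insertionSort _).mem_iff.mp ht)
  simp only [List.nil_append]
  generalize l.insertionSort (· ≥ ·) = s at hs hd
  simp only [listValue, bellman]
  congr 2
  refine observe_congr fun a q b hq _ => ?_
  have hsub : (q ++ (s.drop K).map (updateBelief p01 p11)).Sublist
      (s.map (updateBelief p01 p11)) := by
    conv_rhs => rw [← List.take_append_drop K s, List.map_append]
    exact hq.append_right _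
  have hs' : (q ++ (s.drop K).map (updateBelief p01 p11)).Pairwise (· ≥ ·) :=
    (List.pairwise_map.mpr (hs.imp fun h => updateBelief_mono h01 h)).sublist hsub
  have hd' : ∀ t ∈ q ++ (s.drop K).map (updateBelief p01 p11), t ∈ Set.Icc p01 p11 := fun t ht =>
    mem_Icc_of_mem_map_updateBelief h01 hd t (hsub.subset ht)
  rw [insertionSort_eq_of_perm (List.Perm.refl _)]
  rw [← List.append_assoc q]
  refine List.pairwise_append.mpr ⟨by simp [List.pairwise_replicate], List.pairwise_append.mpr
    ⟨hs', by simp [List.pairwise_replicate], fun t ht u hu => ?_⟩, fun t ht u hu => ?_⟩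
  · rw [List.eq_of_mem_replicate hu]; exact (hd' t ht).1
  · rw [List.eq_of_mem_replicate ht]
    rcases List.mem_append.mp hu with hu | hu
    · exact (hd' u hu).2
    · rw [List.eq_of_mem_replicate hu]; exact h01

end ListValue

section Bridge

variable {N K T : ℕ} {β p p01 p11 : ℝ}

lemma sum_powerset_eq_observe {N : ℕ} (p : ℝ) (τ : ℝ → ℝ) (v : Fin N → ℝ) (S : Finset (Fin N)) :
    ∀ Φ : ℕ → List ℝ → ℕ → ℝ,
    ∑ E ∈ S.powerset, ∑ H ∈ E.powerset,
      ((1 - p) ^ (S.card - E.card) * p ^ E.card * (∏ j ∈ H, v j) * (∏ j ∈ E \ H, (1 - v j))) *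
        Φ H.card (((S \ E).sort (· ≤ ·)).map (fun j => τ (v j))) (E.card - H.card) =
      observe p τ ((S.sort (· ≤ ·)).map v) Φ := by
  induction S using Finset.induction_on_min with
  | empty => intro Φ; simp [observe]
  | insert a S ha ih =>
    intro Φ
    have haS : a ∉ S := fun h => lt_irrefl _ (ha a h)
    rw [Finset.sort_insert _ (fun b hb => (ha b hb).le) haS, List.map_cons, observe, ← ih, ← ih,
      ← ih, Finset.sum_powerset_insert haS, add_assoc]
    simp only [Finset.mul_sum]
    congr 1
    · refine Finset.sum_congr rfl fun E hE => Finset.sum_congr rfl fun H hH => ?_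
      have hES := Finset.mem_powerset.mp hE
      have hcard := Finset.card_le_card hES
      have haE : a ∉ E := fun h => haS (hES h)
      rw [Finset.insert_sdiff_of_notMem _ haE, Finset.sort_insert _ (fun b hb =>
        (ha b (Finset.mem_sdiff.mp hb).1).le) (fun h => haS (Finset.mem_sdiff.mp h).1),
        Finset.card_insert_of_notMem haS, Nat.succ_sub hcard, pow_succ, List.map_cons]
      ring
    · rw [← Finset.sum_add_distrib]
      refine Finset.sum_congr rfl fun E hE => ?_
      have hES := Finset.mem_powerset.mp hE
      have haE : a ∉ E := fun h => haS (hES h)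
      rw [Finset.sum_powerset_insert haE, add_comm, ← Finset.sum_add_distrib,
        ← Finset.sum_add_distrib]
      refine Finset.sum_congr rfl fun H hH => ?_
      have hHE := Finset.mem_powerset.mp hH
      have haH : a ∉ H := fun h => haE (hHE h)
      have hcard := Finset.card_le_card hHE
      have e1 : insert a S \ insert a E = S \ E := by
        rw [Finset.insert_sdiff_insert, Finset.sdiff_insert_of_notMem haS]
      have e2 : insert a E \ insert a H = E \ H := by
        rw [Finset.insert_sdiff_insert, Finset.sdiff_insert_of_notMem haE]
      have e3 : a ∉ E \ H := fun h => haE (Finset.mem_sdiff.mp h).1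
      rw [e1, e2, Finset.insert_sdiff_of_notMem _ haH, Finset.prod_insert e3,
        Finset.prod_insert haH, Finset.card_insert_of_notMem haS, Finset.card_insert_of_notMem haE,
        Finset.card_insert_of_notMem haH, Nat.add_sub_add_right, Nat.add_sub_add_right,
        Nat.succ_sub hcard, pow_succ]
      ring

lemma sort_sdiff_of_subset {E S : Finset (Fin N)} (hE : E ⊆ S)
    (hS : ∀ i ∈ S, ∀ j ∉ S, i < j) :
    (Finset.univ \ E).sort (· ≤ ·) =
      (S \ E).sort (· ≤ ·) ++ (Finset.univ \ S).sort (· ≤ ·) := by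
  refine List.Perm.eq_of_pairwise' (r := (· ≤ ·)) (Finset.pairwise_sort _ _) ?_ ?_
  · refine List.pairwise_append.mpr ⟨Finset.pairwise_sort _ _, Finset.pairwise_sort _ _, ?_⟩
    intro i hi j hj
    simp only [Finset.mem_sort, Finset.mem_sdiff, Finset.mem_univ, true_and] at hi hj
    exact (hS i hi.1 j hj).le
  · refine (List.perm_ext_iff_of_nodup (Finset.sort_nodup _ _) ?_).mpr fun i => ?_
    · refine List.nodup_append.mpr ⟨Finset.sort_nodup _ _, Finset.sort_nodup _ _, ?_⟩
      rintro i hi j hj rfl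
      simp only [Finset.mem_sort, Finset.mem_sdiff, Finset.mem_univ, true_and] at hi hj
      exact hj hi.1
    · simp only [List.mem_append, Finset.mem_sort, Finset.mem_sdiff, Finset.mem_univ, true_and]
      have := @hE i
      tauto

lemma ofFn_getD {l : List ℝ} (hl : l.length = N) :
    List.ofFn (fun i : Fin N => l.getD i.val 0) = l := by
  subst hl
  refine List.ext_getElem (by simp) fun i h₁ h₂ => ?_
  simp

lemma ofFn_nextVec2 {E H : Finset (Fin N)} (hH : H ⊆ E) (v : Fin N → ℝ) :
    List.ofFn (nextVec2 N p01 p11 E H v) = List.replicate H.card p11 ++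
      ((Finset.univ \ E).sort (· ≤ ·)).map (fun j => updateBelief p01 p11 (v j)) ++
      List.replicate (E.card - H.card) p01 := by
  refine ofFn_getD ?_
  have hHE := Finset.card_le_card hH
  have hEN := Finset.card_le_univ E
  rw [Fintype.card_fin] at hEN
  simp [Finset.card_univ_sdiff]
  omega

lemma sum_sort_map (S : Finset (Fin N)) (v : Fin N → ℝ) :
    ((S.sort (· ≤ ·)).map v).sum = ∑ i ∈ S, v i := by
  rw [← Finset.sum_map_toList]
  exact ((Finset.sort_perm_toList S (· ≤ ·)).map v).sum_eq

lemma card_sched (hKN : K ≤ N) : (sched N K).card = K := by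
  rw [sched, Fin.card_filter_val_lt, min_eq_right hKN]

lemma W2_eq_listValue (hKN : K ≤ N) (m : ℕ) : ∀ v : Fin N → ℝ,
    W2 N K β p p01 p11 m v = listValue K β p p01 p11 (m + 1) (List.ofFn v) := by
  have hlt : ∀ i ∈ sched N K, ∀ j ∉ sched N K, i < j := by
    intro i hi j hj
    simp only [sched, Finset.mem_filter, Finset.mem_univ, true_and, not_lt] at hi hj
    exact Fin.lt_def.mpr (hi.trans_le hj)
  have hsplit : ∀ v : Fin N → ℝ, List.ofFn v = ((sched N K).sort (· ≤ ·)).map v ++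
      ((Finset.univ \ sched N K).sort (· ≤ ·)).map v := by
    intro v
    have := sort_sdiff_of_subset (Finset.empty_subset _) hlt
    rw [Finset.sdiff_empty, Finset.sdiff_empty, Fin.sort_univ] at this
    rw [List.ofFn_eq_map, this, List.map_append]
  have hstep : ∀ G v, bellman K β p p01 p11 G (List.ofFn v) = _ := fun G v => by
    rw [hsplit v, bellman_append (by simp [card_sched hKN]), sum_sort_map]
  induction m with
  | zero =>
    intro v
    simp [W2, listValue, hstep, observe_const]
  | succ m ih =>
    intro v
    rw [W2, listValue, hstep, ← sum_powerset_eq_observe, card_sched hKN]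
    congr 2
    refine Finset.sum_congr rfl fun E hE => Finset.sum_congr rfl fun H hH => ?_
    have hES := Finset.mem_powerset.mp hE
    rw [ih, ofFn_nextVec2 (Finset.mem_powerset.mp hH), sort_sdiff_of_subset hES hlt]
    simp only [List.map_append, List.append_assoc, List.map_map]
    rfl

lemma ofFn_sortVec (v : Fin N → ℝ) :
    List.ofFn (sortVec N v) = (List.ofFn v).insertionSort (· ≥ ·) := by
  refine (ofFn_getD (by simp)).trans (insertionSort_eq_of_perm (List.mergeSort_perm _ _).symm ?_).symm
  exact List.pairwise_mergeSort' (· ≥ ·) _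

lemma ofFn_next_perm {A E H : Finset (Fin N)} (hE : E ⊆ A) (hH : H ⊆ E) (s : Fin N → ℝ) :
    (List.ofFn (fun i => if i ∈ H then p11 else if i ∈ E then p01
      else (p11 - p01) * s i + p01)).Perm
    (List.replicate H.card p11 ++ (((A \ E).sort (· ≤ ·)).map
      (fun j => updateBelief p01 p11 (s j)) ++
      ((((Finset.univ \ A).sort (· ≤ ·)).map s).map (updateBelief p01 p11) ++
        List.replicate (E.card - H.card) p01))) := by
  have hperm : (List.finRange N).Perm (H.sort (· ≤ ·) ++ ((A \ E).sort (· ≤ ·) ++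
      ((Finset.univ \ A).sort (· ≤ ·) ++ (E \ H).sort (· ≤ ·)))) := by
    refine (List.perm_ext_iff_of_nodup (List.nodup_finRange N) ?_).mpr fun i => ?_
    · simp only [List.nodup_append, Finset.sort_nodup, true_and, List.mem_append, Finset.mem_sort,
        Finset.mem_sdiff, Finset.mem_univ]
      refine ⟨⟨?_, ?_⟩, ?_⟩ <;>
      · rintro i hi j hj rfl
        have h₁ := @hE i
        have h₂ := @hH i
        tauto
    · simp only [List.mem_finRange, List.mem_append, Finset.mem_sort, Finset.mem_sdiff,
        Finset.mem_univ, true_and, true_iff]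
      tauto
  rw [List.ofFn_eq_map]
  refine (hperm.map _).trans (List.Perm.of_eq ?_)
  simp only [List.map_append]
  congr 1
  · rw [← Finset.length_sort (s := H) (· ≤ ·), ← List.map_const']
    exact List.map_congr_left fun i hi => if_pos ((Finset.mem_sort _).mp hi)
  congr 1
  · refine List.map_congr_left fun i hi => ?_
    have hi' := Finset.mem_sdiff.mp ((Finset.mem_sort _).mp hi)
    rw [if_neg fun h => hi'.2 (hH h), if_neg hi'.2, updateBelief]
  congr 1
  · rw [List.map_map]
    refine List.map_congr_left fun i hi => ?_
    have hi' := (Finset.mem_sdiff.mp ((Finset.mem_sort _).mp hi)).2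
    rw [if_neg fun h => hi' (hE (hH h)), if_neg fun h => hi' (hE h), Function.comp, updateBelief]
  · rw [← Finset.card_sdiff_of_subset hH, ← Finset.length_sort (s := E \ H) (· ≤ ·),
      ← List.map_const']
    refine List.map_congr_left fun i hi => ?_
    have hi' := Finset.mem_sdiff.mp ((Finset.mem_sort _).mp hi)
    rw [if_neg hi'.2, if_pos hi'.1]

lemma bellman_sort_append (A : Finset (Fin N)) (hA : A.card = K) (G : List ℝ → ℝ)
    (s : Fin N → ℝ) :
    bellman K β p p01 p11 G ((A.sort (· ≤ ·)).map s ++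
      ((Finset.univ \ A).sort (· ≤ ·)).map s) =
    p * ∑ i ∈ A, s i + β * ∑ E ∈ A.powerset, ∑ H ∈ E.powerset,
      ((1 - p) ^ (K - E.card) * p ^ E.card * (∏ j ∈ H, s j) * (∏ j ∈ E \ H, (1 - s j))) *
        G (List.replicate H.card p11 ++ (((A \ E).sort (· ≤ ·)).map
          (fun j => updateBelief p01 p11 (s j)) ++
          ((((Finset.univ \ A).sort (· ≤ ·)).map s).map (updateBelief p01 p11) ++
            List.replicate (E.card - H.card) p01))) := by
  rw [bellman_append (by simpa using hA), sum_sort_map, ← sum_powerset_eq_observe, hA]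

lemma V2_le_listValue (hK : 1 ≤ K) (hβ0 : 0 ≤ β) (hβ1 : β ≤ 1) (hp0 : 0 ≤ p) (hp1 : p ≤ 1)
    (h0 : 0 ≤ p01) (h01 : p01 ≤ p11) (h1 : p11 ≤ 1)
    (pol : ℕ → (Fin N → ℝ) → Finset (Fin N)) (hpol : ∀ m s, (pol m s).card = K) (m : ℕ) :
    ∀ s : Fin N → ℝ, (∀ i, s i ∈ Set.Icc (0 : ℝ) 1) →
      V2 N K T β p p01 p11 pol m s ≤
        listValue K β p p01 p11 (m + 1) ((List.ofFn s).insertionSort (· ≥ ·)) := by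
  have hmyopic : ∀ (m : ℕ) (A : Finset (Fin N)) (s : Fin N → ℝ),
      (∀ i, s i ∈ Set.Icc (0 : ℝ) 1) →
      bellman K β p p01 p11 (fun q => listValue K β p p01 p11 m (q.insertionSort (· ≥ ·)))
        ((A.sort (· ≤ ·)).map s ++ ((Finset.univ \ A).sort (· ≤ ·)).map s) ≤
      listValue K β p p01 p11 (m + 1) ((List.ofFn s).insertionSort (· ≥ ·)) := by
    intro m A s hs
    refine (bellman_le_listValue hK hβ0 hβ1 hp0 hp1 h0 h01 h1 m ?_).trans_eq ?_
    · simp only [List.mem_append, List.mem_map]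
      rintro t (⟨i, -, rfl⟩ | ⟨i, -, rfl⟩) <;> exact hs i
    · refine congrArg _ (insertionSort_congr ?_)
      rw [List.ofFn_eq_map, ← List.map_append]
      refine List.Perm.map _ ((List.perm_ext_iff_of_nodup ?_ (List.nodup_finRange N)).mpr
        fun i => ?_)
      · refine List.nodup_append.mpr ⟨Finset.sort_nodup _ _, Finset.sort_nodup _ _, ?_⟩
        rintro i hi j hj rfl
        simp only [Finset.mem_sort, Finset.mem_sdiff] at hi hj
        exact hj.2 hi
      · simp only [List.mem_append, Finset.mem_sort, Finset.mem_sdiff, Finset.mem_univ, true_and,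
          List.mem_finRange, iff_true]
        tauto
  induction m with
  | zero =>
    intro s hs
    refine le_trans (le_of_eq ?_) (hmyopic 0 (pol T s) s hs)
    rw [bellman_sort_append _ (hpol _ _)]
    simp [V2, listValue]
  | succ m ih =>
    intro s hs
    refine le_trans ?_ (hmyopic (m + 1) (pol (T - (m + 1)) s) s hs)
    rw [bellman_sort_append _ (hpol _ _), V2]
    gcongr with E hE H hH
    · have hp1' := sub_nonneg.mpr hp1
      exact mul_nonneg (mul_nonneg (by positivity) (Finset.prod_nonneg fun i _ => (hs i).1))
        (Finset.prod_nonneg fun i _ => sub_nonneg.mpr (hs i).2)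
    · rw [← insertionSort_congr (ofFn_next_perm (Finset.mem_powerset.mp hE)
        (Finset.mem_powerset.mp hH) s)]
      refine ih _ fun i => ?_
      split_ifs
      · exact ⟨h0.trans h01, h1⟩
      · exact ⟨h0, h01.trans h1⟩
      · have := updateBelief_mem h01 (hs i)
        exact ⟨h0.trans this.1, this.2.trans h1⟩

end Bridge

/-- Theorem 3: in the batteryless model with reward `R(v) = p·Σ_{i=1}^K v_i`, if
`0 ≤ p01 ≤ p11 ≤ 1` and `β ∈ (0,1]`, the myopic policy is optimal: for every scheduling
policy, every time `1 ≤ n ≤ T` and every belief vector `s`, `V^π_n(s) ≤ W_n(sort s)`. -/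
theorem batteryless_myopic_policy_optimal
    (N K T : ℕ) (hK : 1 ≤ K) (hKN : K ≤ N) (hT : 1 ≤ T)
    (β p p01 p11 : ℝ) (hβ0 : 0 < β) (hβ1 : β ≤ 1) (hp0 : 0 ≤ p) (hp1 : p ≤ 1)
    (hp010 : 0 ≤ p01) (hp0111 : p01 ≤ p11) (hp111 : p11 ≤ 1) :
    ∀ pol : ℕ → (Fin N → ℝ) → Finset (Fin N),
      (∀ m s, (pol m s).card = K) →
      ∀ n : ℕ, 1 ≤ n → n ≤ T →
      ∀ s : Fin N → ℝ, (∀ i, s i ∈ Set.Icc (0 : ℝ) 1) →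
        V2 N K T β p p01 p11 pol (T - n) s ≤
          W2 N K β p p01 p11 (T - n) (sortVec N s) := by
  intro pol hpol n _ _ s hs
  rw [W2_eq_listValue hKN, ofFn_sortVec]
  exact V2_le_listValue hK hβ0.le hβ1 hp0 hp1 hp010 hp0111 hp111 pol hpol _ s hs
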